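/- Let A₁ and A₂ be complex matrices of sizes m × n₁ and m × n₂ respectively, with n₁, n₂ ≥ m, both of rank m, and suppose the product of the singular values of A₁ equals the product of the singular values of A₂. Then there exist unitary matrices U (m × m), V₁ (n₁ × n₁), V₂ (n₂ × n₂) and m × n₁, m × n₂ matrices T₁, T₂ that are generalized lower triangular (all entries strictly above the main diagonal are zero) with A₁ = U T₁ V₁* and A₂ = U T₂ V₂*, such that for each k, the diagonal entries satisfy (T₁)ₖₖ = (T₂)ₖₖ > 0. -/

import Mathlib

open Matrix BigOperators

/-- Singular values of an `m × n` complex matrix: the nonnegative square roots of the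
eigenvalues of `A * Aᴴ`. -/
noncomputable def singularValues {m n : ℕ} (A : Matrix (Fin m) (Fin n) ℂ) : Fin m → ℝ :=
  fun k => Real.sqrt ((Matrix.isHermitian_mul_conjTranspose_self A).eigenvalues k)

section Aux
open scoped ComplexOrder

lemma aux_unitary_col {n : ℕ} (x : Fin (n+1) → ℂ) (hx : x ≠ 0) :
    ∃ V ∈ Matrix.unitaryGroup (Fin (n+1)) ℂ, ∃ r : ℝ, 0 < r ∧ ((r:ℂ)^2 = star x ⬝ᵥ x) ∧
      ∀ i, x i = r * V i 0 := by
  set e : EuclideanSpace ℂ (Fin (n+1)) := WithLp.toLp 2 x with he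
  have he0 : e ≠ 0 := by
    intro h
    apply hx
    funext i
    have := congrArg (fun z : EuclideanSpace ℂ (Fin (n+1)) => z i) h
    simpa [he] using this
  have hr : 0 < ‖e‖ := norm_pos_iff.mpr he0
  obtain ⟨b, hb⟩ := Orthonormal.exists_orthonormalBasis_extension_of_card_eq (𝕜 := ℂ)
    (E := EuclideanSpace ℂ (Fin (n+1))) (ι := Fin (n+1)) (by simp)
    (v := fun _ => ((‖e‖ : ℂ)⁻¹) • e) (s := {0}) (by
      constructor
      · intro i
        simp [norm_smul, hr.ne']
      · intro i j hij
        exact absurd (Subsingleton.elim i j) hij)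
  refine ⟨Matrix.of fun i j => b j i, ?_, ‖e‖, hr, ?_, ?_⟩
  · rw [Matrix.mem_unitaryGroup_iff']
    ext i j
    have h := orthonormal_iff_ite.mp b.orthonormal i j
    rw [PiLp.inner_apply] at h
    simp only [Matrix.mul_apply, Matrix.star_apply, Matrix.of_apply, Matrix.one_apply]
    rw [← h]
    refine Finset.sum_congr rfl fun k _ => ?_
    simp [mul_comm]
  · have h := inner_self_eq_norm_sq_to_K (𝕜 := ℂ) e
    rw [PiLp.inner_apply] at h
    simp only [dotProduct]
    refine Eq.trans h.symm ?_
    refine Finset.sum_congr rfl fun k _ => ?_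
    simp only [he, Pi.star_apply]
    exact mul_comm _ _
  · intro i
    have h := hb 0 rfl
    simp only [Matrix.of_apply, h]
    have : (‖e‖ : ℂ) ≠ 0 := by exact_mod_cast hr.ne'
    rw [PiLp.smul_apply, smul_eq_mul, mul_inv_cancel_left₀ this]

lemma aux_det_row {n : ℕ} (M : Matrix (Fin (n+1)) (Fin (n+1)) ℂ)
    (h : ∀ j : Fin n, M 0 j.succ = 0) :
    M.det = M 0 0 * (M.submatrix Fin.succ Fin.succ).det := by
  rw [Matrix.det_succ_row_zero, Fin.sum_univ_succ]
  simp [h]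

lemma aux_det_col {n : ℕ} (M : Matrix (Fin (n+1)) (Fin (n+1)) ℂ)
    (h : ∀ j : Fin n, M j.succ 0 = 0) :
    M.det = M 0 0 * (M.submatrix Fin.succ Fin.succ).det := by
  rw [Matrix.det_succ_column_zero, Fin.sum_univ_succ]
  simp [h]

lemma aux_det_block {m n : ℕ} (S : Matrix (Fin (m+1)) (Fin (n+1)) ℂ) (t : ℝ)
    (h00 : S 0 0 = t) (h0 : ∀ j : Fin n, S 0 j.succ = 0) :
    (S * Sᴴ).det = (t:ℂ)^2 *
      (S.submatrix Fin.succ Fin.succ * (S.submatrix Fin.succ Fin.succ)ᴴ).det := by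
  set A' := S.submatrix Fin.succ Fin.succ with hA
  let P : Matrix (Fin (m+1)) (Fin (m+1)) ℂ := Matrix.of
    (Fin.cons (Fin.cons (t:ℂ) 0) (fun i => Fin.cons (S i.succ 0) ((A' * A'ᴴ) i)))
  let Q : Matrix (Fin (m+1)) (Fin (m+1)) ℂ := Matrix.of
    (Fin.cons (Fin.cons (t:ℂ) (fun j => star (S j.succ 0))) (fun i => Fin.cons 0 ((1 : Matrix (Fin m) (Fin m) ℂ) i)))
  have hPQ : S * Sᴴ = P * Q := by
    ext i j
    rw [Matrix.mul_apply, Matrix.mul_apply, Fin.sum_univ_succ, Fin.sum_univ_succ]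
    refine Fin.cases ?_ (fun i => ?_) i <;> refine Fin.cases ?_ (fun j => ?_) j
    · simp [P, Q, h00, h0]
    · simp [P, Q, h00, h0]
    · simp [P, Q, h00, h0]
    · simp [P, Q, Matrix.one_apply]
      simp [Matrix.mul_apply, hA]
  rw [hPQ, Matrix.det_mul, aux_det_row P (by intro j; simp [P]),
    aux_det_col Q (by intro j; simp [Q])]
  have hP : P.submatrix Fin.succ Fin.succ = A' * A'ᴴ := by ext i j; simp [P]
  have hQ : Q.submatrix Fin.succ Fin.succ = 1 := by ext i j; simp [Q]
  rw [hP, hQ]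
  simp [P, Q]
  ring

lemma aux_det_conj {m n : ℕ} (A : Matrix (Fin m) (Fin n) ℂ) (W : Matrix (Fin m) (Fin m) ℂ)
    (V : Matrix (Fin n) (Fin n) ℂ)
    (hW : W ∈ Matrix.unitaryGroup (Fin m) ℂ) (hV : V ∈ Matrix.unitaryGroup (Fin n) ℂ) :
    ((Wᴴ * A * V) * (Wᴴ * A * V)ᴴ) = Wᴴ * (A * Aᴴ) * W ∧
    ((Wᴴ * A * V) * (Wᴴ * A * V)ᴴ).det = (A * Aᴴ).det := by
  have hv : V * Vᴴ = 1 := Matrix.mem_unitaryGroup_iff.mp hV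
  have hw : W * Wᴴ = 1 := Matrix.mem_unitaryGroup_iff.mp hW
  have h : ((Wᴴ * A * V) * (Wᴴ * A * V)ᴴ) = Wᴴ * (A * Aᴴ) * W := by
    simp only [Matrix.conjTranspose_mul, Matrix.conjTranspose_conjTranspose]
    calc _ = Wᴴ * A * (V * Vᴴ) * Aᴴ * W := by simp only [Matrix.mul_assoc]
      _ = _ := by rw [hv]; simp only [Matrix.mul_assoc, Matrix.mul_one]
  refine ⟨h, ?_⟩
  rw [h, Matrix.det_mul, Matrix.det_mul]
  have : W.det * (Wᴴ).det = 1 := by rw [← Matrix.det_mul, hw, Matrix.det_one]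
  linear_combination (A * Aᴴ).det * this

lemma aux_step {m n : ℕ} (A : Matrix (Fin (m+1)) (Fin (n+1)) ℂ)
    (W : Matrix (Fin (m+1)) (Fin (m+1)) ℂ) (hW : W ∈ Matrix.unitaryGroup (Fin (m+1)) ℂ)
    (hd : (A * Aᴴ).det ≠ 0) :
    ∃ V ∈ Matrix.unitaryGroup (Fin (n+1)) ℂ, ∃ t : ℝ, 0 < t ∧
      (t:ℂ)^2 = (Wᴴ * (A * Aᴴ) * W) 0 0 ∧ (Wᴴ * A * V) 0 0 = t ∧
      (∀ j : Fin n, (Wᴴ * A * V) 0 j.succ = 0) := by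
  set R := Wᴴ * A with hR
  have hx : star (R 0) ≠ 0 := by
    intro h
    have h' : R 0 = 0 := by simpa using h
    apply hd
    rw [← (aux_det_conj A W 1 hW (one_mem _)).2, Matrix.mul_one, ← hR]
    apply Matrix.det_eq_zero_of_row_eq_zero 0
    intro j
    rw [Matrix.mul_apply]
    simp [h']
  obtain ⟨V, hV, r, hr, hr2, hxV⟩ := aux_unitary_col _ hx
  have hvv : Vᴴ * V = 1 := Matrix.mem_unitaryGroup_iff'.mp hV
  have key : ∀ j, (R * V) 0 j = r * (1 : Matrix (Fin (n+1)) (Fin (n+1)) ℂ) 0 j := by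
    intro j
    rw [← hvv, Matrix.mul_apply, Matrix.mul_apply, Finset.mul_sum]
    refine Finset.sum_congr rfl fun k _ => ?_
    have := congrArg star (hxV k)
    simp at this
    rw [this]
    simp [mul_assoc]
  refine ⟨V, hV, r, hr, ?_, ?_, ?_⟩
  · rw [← (aux_det_conj A W 1 hW (one_mem _)).1, Matrix.mul_one, ← hR, hr2, Matrix.mul_apply]
    simp [dotProduct]
  · rw [key]; simp
  · intro j; rw [key]; simp [Matrix.one_apply, (Fin.succ_ne_zero j).symm]

lemma aux_one {n : ℕ} (M : Matrix (Fin (n+1)) (Fin (n+1)) ℂ) (hM : M.PosDef) (hd : M.det = 1) :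
    ∃ y : Fin (n+1) → ℂ, y ≠ 0 ∧ star y ⬝ᵥ (M *ᵥ y) = star y ⬝ᵥ y := by
  have hH := hM.isHermitian
  have hprod : ∏ i, hH.eigenvalues i = 1 := by
    have := hH.det_eq_prod_eigenvalues
    rw [hd] at this
    apply Complex.ofReal_injective
    rw [Complex.ofReal_prod, Complex.ofReal_one]
    exact this.symm
  have h1 : ∃ i, hH.eigenvalues i ≤ 1 := by
    by_contra! h
    have : ∏ i : Fin (n+1), (1:ℝ) < ∏ i, hH.eigenvalues i :=
      Finset.prod_lt_prod_of_nonempty (fun _ _ => one_pos) (fun i _ => h i) Finset.univ_nonempty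
    rw [hprod] at this
    simp at this
  have h2 : ∃ i, 1 ≤ hH.eigenvalues i := by
    by_contra! h
    have : ∏ i, hH.eigenvalues i < ∏ i : Fin (n+1), (1:ℝ) :=
      Finset.prod_lt_prod_of_nonempty (fun i _ => hM.eigenvalues_pos i) (fun i _ => h i)
        Finset.univ_nonempty
    rw [hprod] at this
    simp at this
  obtain ⟨i, hi⟩ := h1
  obtain ⟨j, hj⟩ := h2
  set v : Fin (n+1) → Fin (n+1) → ℂ := fun k => ⇑(hH.eigenvectorBasis k) with hv
  have hMv : ∀ k, M *ᵥ v k = (hH.eigenvalues k : ℂ) • v k := fun k => by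
    have := hH.mulVec_eigenvectorBasis k
    simp only [hv]
    rw [this]
    ext; simp
  have hon : ∀ k l, star (v k) ⬝ᵥ v l = if k = l then 1 else 0 := by
    intro k l
    have h := orthonormal_iff_ite.mp hH.eigenvectorBasis.orthonormal k l
    rw [PiLp.inner_apply] at h
    rw [← h]
    refine Finset.sum_congr rfl fun k _ => ?_
    simp [mul_comm, hv]
  rcases hi.eq_or_lt with hi1 | hi1
  · refine ⟨v i, ?_, ?_⟩
    · intro h
      have := hon i i
      rw [h] at this
      simp at this
    · rw [hMv, hi1]; simp
  · have hij : i ≠ j := by rintro rfl; linarith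
    set c : ℝ := Real.sqrt (hH.eigenvalues j - 1)
    set s : ℝ := Real.sqrt (1 - hH.eigenvalues i)
    have hc : (c:ℂ)^2 = hH.eigenvalues j - 1 := by
      have : c^2 = hH.eigenvalues j - 1 := Real.sq_sqrt (by linarith)
      exact_mod_cast this
    have hs' : 0 < s := Real.sqrt_pos.mpr (by linarith)
    have hs : (s:ℂ)^2 = 1 - hH.eigenvalues i := by
      have : s^2 = 1 - hH.eigenvalues i := Real.sq_sqrt (by linarith)
      exact_mod_cast this
    refine ⟨(c:ℂ) • v i + (s:ℂ) • v j, ?_, ?_⟩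
    · intro h
      have h3 : star (v j) ⬝ᵥ ((c:ℂ) • v i + (s:ℂ) • v j) = 0 := by rw [h]; simp
      rw [dotProduct_add, dotProduct_smul, dotProduct_smul, hon, hon] at h3
      simp [hij.symm] at h3
      exact hs'.ne' h3
    · simp only [Matrix.mulVec_add, Matrix.mulVec_smul, hMv, star_add, star_smul, add_dotProduct,
        dotProduct_add, smul_dotProduct, dotProduct_smul, hon, hij, hij.symm]
      simp
      linear_combination (hH.eigenvalues i - 1 : ℂ) * hc + (hH.eigenvalues j - 1 : ℂ) * hs

open scoped MatrixOrder Matrix.Norms.L2Operator in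
lemma aux_fact {n : ℕ} (G : Matrix (Fin n) (Fin n) ℂ) (h : G.PosSemidef) :
    ∃ B : Matrix (Fin n) (Fin n) ℂ, G = Bᴴ * B :=
  CStarAlgebra.nonneg_iff_eq_star_mul_self.mp h.nonneg

lemma aux_two {n : ℕ} (G₁ G₂ : Matrix (Fin (n+1)) (Fin (n+1)) ℂ) (h1 : G₁.PosDef)
    (h2 : G₂.PosDef) (hd : G₁.det = G₂.det) :
    ∃ x : Fin (n+1) → ℂ, x ≠ 0 ∧ star x ⬝ᵥ (G₁ *ᵥ x) = star x ⬝ᵥ (G₂ *ᵥ x) := by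
  obtain ⟨B, hB⟩ := aux_fact _ h2.posSemidef
  have hB0 : B.det ≠ 0 := by
    intro h
    have := h2.det_pos.ne'
    rw [hB, Matrix.det_mul, h] at this
    simp at this
  have hBu : IsUnit B.det := isUnit_iff_ne_zero.mpr hB0
  set C := B⁻¹ with hC
  have hBC : B * C = 1 := Matrix.mul_nonsing_inv _ hBu
  have hCB : C * B = 1 := Matrix.nonsing_inv_mul _ hBu
  have hinj : Function.Injective C.mulVec := by
    intro a b hab
    have := congrArg (fun z => B *ᵥ z) hab
    simpa [Matrix.mulVec_mulVec, hBC] using this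
  have hM : (Cᴴ * G₁ * C).PosDef := h1.conjTranspose_mul_mul_same hinj
  have hG2 : Cᴴ * G₂ * C = 1 := by
    calc Cᴴ * G₂ * C = (B * C)ᴴ * (B * C) := by
          rw [hB, Matrix.conjTranspose_mul]; simp only [Matrix.mul_assoc]
      _ = 1 := by rw [hBC]; simp
  have hMd : (Cᴴ * G₁ * C).det = 1 := by
    rw [Matrix.det_mul, Matrix.det_mul, hd, ← Matrix.det_mul, ← Matrix.det_mul, hG2, Matrix.det_one]
  obtain ⟨y, hy, hyy⟩ := aux_one _ hM hMd
  have hq : ∀ G : Matrix (Fin (n+1)) (Fin (n+1)) ℂ,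
      star (C *ᵥ y) ⬝ᵥ (G *ᵥ (C *ᵥ y)) = star y ⬝ᵥ ((Cᴴ * G * C) *ᵥ y) := by
    intro G
    rw [Matrix.star_mulVec, ← Matrix.dotProduct_mulVec, Matrix.mulVec_mulVec, Matrix.mulVec_mulVec,
      Matrix.mul_assoc]
  refine ⟨C *ᵥ y, ?_, ?_⟩
  · intro h
    exact hy (hinj (by simpa using h))
  · rw [hq, hq, hyy, hG2, Matrix.one_mulVec]

lemma aux_posDef {m n : ℕ} (A : Matrix (Fin m) (Fin n) ℂ) (hd : (A * Aᴴ).det ≠ 0) :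
    (A * Aᴴ).PosDef := by
  have h := Matrix.posSemidef_self_mul_conjTranspose A
  exact h.posDef_iff_isUnit.mpr ((Matrix.isUnit_iff_isUnit_det _).mpr (isUnit_iff_ne_zero.mpr hd))

/-- The block matrix `1 ⊕ U`. -/
def auxExt {n : ℕ} (U : Matrix (Fin n) (Fin n) ℂ) : Matrix (Fin (n+1)) (Fin (n+1)) ℂ :=
  Matrix.of (Fin.cons (Fin.cons 1 0) (fun i => Fin.cons 0 (U i)))

lemma auxExt_mem {n : ℕ} (U : Matrix (Fin n) (Fin n) ℂ) (hU : U ∈ Matrix.unitaryGroup (Fin n) ℂ) :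
    auxExt U ∈ Matrix.unitaryGroup (Fin (n+1)) ℂ := by
  rw [Matrix.mem_unitaryGroup_iff] at *
  ext i j
  rw [Matrix.mul_apply, Fin.sum_univ_succ]
  refine Fin.cases ?_ (fun i => ?_) i <;> refine Fin.cases ?_ (fun j => ?_) j
  · simp [auxExt]
  · simp [auxExt, Matrix.one_apply, (Fin.succ_ne_zero j).symm]
  · simp [auxExt, Matrix.one_apply]
  · have := congrFun (congrFun hU i) j
    rw [Matrix.mul_apply] at this
    simpa [auxExt, Matrix.one_apply] using this

lemma auxExt_mul {m n : ℕ} (S : Matrix (Fin (m+1)) (Fin (n+1)) ℂ) (U : Matrix (Fin m) (Fin m) ℂ)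
    (V : Matrix (Fin n) (Fin n) ℂ) (h0 : ∀ j : Fin n, S 0 j.succ = 0) :
    ((auxExt U)ᴴ * S * auxExt V) 0 0 = S 0 0 ∧
    (∀ j : Fin n, ((auxExt U)ᴴ * S * auxExt V) 0 j.succ = 0) ∧
    (∀ i j, ((auxExt U)ᴴ * S * auxExt V) (Fin.succ i) (Fin.succ j) =
      (Uᴴ * S.submatrix Fin.succ Fin.succ * V) i j) := by
  refine ⟨?_, ?_, ?_⟩
  · simp [Matrix.mul_apply, Fin.sum_univ_succ, auxExt]
  · intro j
    simp [Matrix.mul_apply, Fin.sum_univ_succ, auxExt, h0]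
  · intro i j
    simp [Matrix.mul_apply, Fin.sum_univ_succ, auxExt]

/-- The compressed matrix is triangular with diagonal `t`. -/
def AuxTri {m n : ℕ} (h : m ≤ n) (T : Matrix (Fin m) (Fin n) ℂ) (t : Fin m → ℝ) : Prop :=
  (∀ i : Fin m, ∀ j : Fin n, (i : ℕ) < (j : ℕ) → T i j = 0) ∧
    ∀ k, T k (Fin.castLE h k) = (t k : ℂ)

lemma aux_tri {m n : ℕ} (h : m ≤ n) (A : Matrix (Fin (m+1)) (Fin (n+1)) ℂ)
    (W : Matrix (Fin (m+1)) (Fin (m+1)) ℂ) (V : Matrix (Fin (n+1)) (Fin (n+1)) ℂ)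
    (U' : Matrix (Fin m) (Fin m) ℂ) (V' : Matrix (Fin n) (Fin n) ℂ) (a : ℝ) (t : Fin m → ℝ)
    (h00 : (Wᴴ * A * V) 0 0 = a) (h0 : ∀ j : Fin n, (Wᴴ * A * V) 0 j.succ = 0)
    (hT : AuxTri h (U'ᴴ * (Wᴴ * A * V).submatrix Fin.succ Fin.succ * V') t) :
    AuxTri (Nat.succ_le_succ h) ((W * auxExt U')ᴴ * A * (V * auxExt V')) (Fin.cons a t) := by
  have he : (W * auxExt U')ᴴ * A * (V * auxExt V') =
      (auxExt U')ᴴ * (Wᴴ * A * V) * auxExt V' := by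
    rw [Matrix.conjTranspose_mul]; simp only [Matrix.mul_assoc]
  rw [he]
  obtain ⟨e1, e2, e3⟩ := auxExt_mul (Wᴴ * A * V) U' V' h0
  constructor
  · intro i j
    refine Fin.cases ?_ (fun i => ?_) i <;> refine Fin.cases ?_ (fun j => ?_) j
    · simp
    · intro _; exact e2 j
    · simp
    · intro hij
      rw [e3]
      exact hT.1 i j (by simpa using hij)
  · intro k
    refine Fin.cases ?_ (fun k => ?_) k
    · rw [Fin.cons_zero, ← h00, ← e1]; rfl
    · rw [Fin.cons_succ, ← hT.2 k, ← e3]; rfl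

lemma aux_main (m : ℕ) : ∀ (n₁ n₂ : ℕ) (h1 : m ≤ n₁) (h2 : m ≤ n₂)
    (A₁ : Matrix (Fin m) (Fin n₁) ℂ) (A₂ : Matrix (Fin m) (Fin n₂) ℂ)
    (_ : (A₁ * A₁ᴴ).det ≠ 0) (_ : (A₁ * A₁ᴴ).det = (A₂ * A₂ᴴ).det),
    ∃ U ∈ Matrix.unitaryGroup (Fin m) ℂ, ∃ V₁ ∈ Matrix.unitaryGroup (Fin n₁) ℂ,
    ∃ V₂ ∈ Matrix.unitaryGroup (Fin n₂) ℂ, ∃ t : Fin m → ℝ, (∀ k, 0 < t k) ∧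
      AuxTri h1 (Uᴴ * A₁ * V₁) t ∧ AuxTri h2 (Uᴴ * A₂ * V₂) t := by
  induction m with
  | zero =>
    intro n₁ n₂ h1 h2 A₁ A₂ _ _
    exact ⟨1, one_mem _, 1, one_mem _, 1, one_mem _, 0, fun k => k.elim0,
      ⟨fun k => k.elim0, fun k => k.elim0⟩, ⟨fun k => k.elim0, fun k => k.elim0⟩⟩
  | succ m ih =>
    intro n₁ n₂ h1 h2 A₁ A₂ hd1 hd
    obtain ⟨n₁, rfl⟩ : ∃ k, n₁ = k + 1 := ⟨n₁ - 1, by omega⟩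
    obtain ⟨n₂, rfl⟩ : ∃ k, n₂ = k + 1 := ⟨n₂ - 1, by omega⟩
    have hd2 : (A₂ * A₂ᴴ).det ≠ 0 := hd ▸ hd1
    obtain ⟨x, hx, hxx⟩ := aux_two _ _ (aux_posDef A₁ hd1) (aux_posDef A₂ hd2) hd
    obtain ⟨W, hW, r, hr, -, hxW⟩ := aux_unitary_col x hx
    obtain ⟨V₁, hV₁, t₁, ht₁, hs₁, h00₁, h0₁⟩ := aux_step A₁ W hW hd1
    obtain ⟨V₂, hV₂, t₂, ht₂, hs₂, h00₂, h0₂⟩ := aux_step A₂ W hW hd2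
    have hq : ∀ G : Matrix (Fin (m+1)) (Fin (m+1)) ℂ,
        star x ⬝ᵥ (G *ᵥ x) = (r:ℂ)^2 * (Wᴴ * G * W) 0 0 := by
      intro G
      have hxe : x = (r:ℂ) • (fun i => W i 0) := funext fun i => by simp [hxW i]
      rw [hxe, star_smul, Matrix.mulVec_smul, smul_dotProduct, dotProduct_smul, Matrix.mul_assoc,
        Matrix.mul_apply]
      simp [dotProduct, Matrix.mulVec, Matrix.mul_apply]
      ring
    have hr0 : (r:ℂ) ≠ 0 := by exact_mod_cast hr.ne'
    have htt : t₁ = t₂ := by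
      rw [hq, hq, ← hs₁, ← hs₂] at hxx
      have h3 := mul_left_cancel₀ (pow_ne_zero 2 hr0) hxx
      have h4 : t₁^2 = t₂^2 := by exact_mod_cast h3
      exact (pow_left_inj₀ ht₁.le ht₂.le two_ne_zero).mp h4
    subst htt
    have ht0 : (t₁:ℂ)^2 ≠ 0 := pow_ne_zero 2 (by exact_mod_cast ht₁.ne')
    have e1 := aux_det_block _ t₁ h00₁ h0₁
    have e2 := aux_det_block _ t₁ h00₂ h0₂
    rw [(aux_det_conj A₁ W V₁ hW hV₁).2] at e1
    rw [(aux_det_conj A₂ W V₂ hW hV₂).2] at e2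
    obtain ⟨U', hU', V₁', hV₁', V₂', hV₂', t, ht, hT1, hT2⟩ := ih n₁ n₂ (by omega) (by omega)
      ((Wᴴ * A₁ * V₁).submatrix Fin.succ Fin.succ) ((Wᴴ * A₂ * V₂).submatrix Fin.succ Fin.succ)
      (by intro h; rw [h, mul_zero] at e1; exact hd1 e1)
      (by rw [e1, e2] at hd; exact mul_left_cancel₀ ht0 hd)
    refine ⟨W * auxExt U', mul_mem hW (auxExt_mem _ hU'), V₁ * auxExt V₁',
      mul_mem hV₁ (auxExt_mem _ hV₁'), V₂ * auxExt V₂', mul_mem hV₂ (auxExt_mem _ hV₂'),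
      Fin.cons t₁ t, ?_, aux_tri _ A₁ W V₁ U' V₁' t₁ t h00₁ h0₁ hT1,
      aux_tri _ A₂ W V₂ U' V₂' t₁ t h00₂ h0₂ hT2⟩
    intro k
    refine Fin.cases ?_ (fun k => ?_) k
    · simpa using ht₁
    · simpa using ht k

lemma aux_sv {m n : ℕ} (A : Matrix (Fin m) (Fin n) ℂ) :
    (A * Aᴴ).det = (((∏ k, singularValues A k) ^ 2 : ℝ) : ℂ) := by
  rw [(Matrix.isHermitian_mul_conjTranspose_self A).det_eq_prod_eigenvalues, ← Finset.prod_pow]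
  push_cast
  refine Finset.prod_congr rfl fun k _ => ?_
  have : singularValues A k ^ 2 = (Matrix.isHermitian_mul_conjTranspose_self A).eigenvalues k :=
    Real.sq_sqrt ((Matrix.posSemidef_self_mul_conjTranspose A).eigenvalues_nonneg k)
  rw [← this]
  push_cast
  rfl

lemma aux_det_ne {m n : ℕ} (A : Matrix (Fin m) (Fin n) ℂ) (hr : A.rank = m) :
    (A * Aᴴ).det ≠ 0 := by
  have h : (A * Aᴴ).rank = Fintype.card (Fin m) := by
    rw [Matrix.rank_self_mul_conjTranspose, hr, Fintype.card_fin]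
  have h' : LinearIndependent ℂ (A * Aᴴ).row := by
    rw [linearIndependent_iff_card_eq_finrank_span, Set.finrank, ← Matrix.rank_eq_finrank_span_row, h]
  have := Matrix.linearIndependent_rows_iff_isUnit.mp h'
  exact ((Matrix.isUnit_iff_isUnit_det _).mp this).ne_zero

lemma aux_recover {m n : ℕ} (A : Matrix (Fin m) (Fin n) ℂ) (U : Matrix (Fin m) (Fin m) ℂ)
    (V : Matrix (Fin n) (Fin n) ℂ)
    (hU : U ∈ Matrix.unitaryGroup (Fin m) ℂ) (hV : V ∈ Matrix.unitaryGroup (Fin n) ℂ) :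
    A = U * (Uᴴ * A * V) * Vᴴ := by
  have hv : V * Vᴴ = 1 := Matrix.mem_unitaryGroup_iff.mp hV
  have hu : U * Uᴴ = 1 := Matrix.mem_unitaryGroup_iff.mp hU
  calc A = (U * Uᴴ) * A * (V * Vᴴ) := by rw [hu, hv]; simp
    _ = _ := by simp only [Matrix.mul_assoc]

end Aux

/-- Joint equi-diagonal triangularization (Theorem 2). -/
theorem joint_equi_diagonal_triangularization
    {m n₁ n₂ : ℕ} (h1 : m ≤ n₁) (h2 : m ≤ n₂)
    (A₁ : Matrix (Fin m) (Fin n₁) ℂ) (A₂ : Matrix (Fin m) (Fin n₂) ℂ)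
    (hr1 : A₁.rank = m) (hr2 : A₂.rank = m)
    (hsv : ∏ k, singularValues A₁ k = ∏ k, singularValues A₂ k) :
    ∃ (U : Matrix (Fin m) (Fin m) ℂ) (V₁ : Matrix (Fin n₁) (Fin n₁) ℂ)
      (V₂ : Matrix (Fin n₂) (Fin n₂) ℂ)
      (T₁ : Matrix (Fin m) (Fin n₁) ℂ) (T₂ : Matrix (Fin m) (Fin n₂) ℂ)
      (t : Fin m → ℝ),
      U ∈ Matrix.unitaryGroup (Fin m) ℂ ∧
      V₁ ∈ Matrix.unitaryGroup (Fin n₁) ℂ ∧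
      V₂ ∈ Matrix.unitaryGroup (Fin n₂) ℂ ∧
      (∀ i : Fin m, ∀ j : Fin n₁, (i : ℕ) < (j : ℕ) → T₁ i j = 0) ∧
      (∀ i : Fin m, ∀ j : Fin n₂, (i : ℕ) < (j : ℕ) → T₂ i j = 0) ∧
      A₁ = U * T₁ * V₁ᴴ ∧
      A₂ = U * T₂ * V₂ᴴ ∧
      (∀ k : Fin m, 0 < t k ∧ T₁ k (Fin.castLE h1 k) = (t k : ℂ) ∧
        T₂ k (Fin.castLE h2 k) = (t k : ℂ)) := by
  have hd : (A₁ * A₁ᴴ).det = (A₂ * A₂ᴴ).det := by rw [aux_sv, aux_sv, hsv]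
  obtain ⟨U, hU, V₁, hV₁, V₂, hV₂, t, ht, hT1, hT2⟩ :=
    aux_main m n₁ n₂ h1 h2 A₁ A₂ (aux_det_ne A₁ hr1) hd
  exact ⟨U, V₁, V₂, Uᴴ * A₁ * V₁, Uᴴ * A₂ * V₂, t, hU, hV₁, hV₂, hT1.1, hT2.1,
    aux_recover A₁ U V₁ hU hV₁, aux_recover A₂ U V₂ hU hV₂,
    fun k => ⟨ht k, hT1.2 k, hT2.2 k⟩⟩
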